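/- arXiv:cond-mat/0605150 — 4 statements merged into one kernel-verified Lean document; each statement's English description precedes it below -/
import Mathlib

section
/- Let P ≥ 1 and let x, y : {1,…,P} → ℤ be strictly increasing maps. Let σ be a permutation of {1,…,P} such that for every i ∈ {1,…,P}: x_i = y_i whenever σ(i) = i; x_i − y_{σ(i)} ≤ i − σ(i) whenever σ(i) < i; and y_{σ(i)} − x_i ≤ σ(i) − i whenever σ(i) > i. Then x_i = y_i for every i, and x_i − x_{σ(i)} = i − σ(i) for every i. -/
open Finset

namespace TASEP

attribute [local instance] Classical.propDecidable

noncomputable section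

/-- Generalized binomial coefficient `C(n,k) = n(n-1)⋯(n-k+1)/k!` for `n : ℤ`, `k : ℕ`. -/
def C (n : ℤ) (k : ℕ) : ℝ :=
  (∏ i ∈ Finset.range k, ((n : ℝ) - (i : ℝ))) / (k.factorial : ℝ)

/-- `λ = v/(1-v)`. -/
def lam (v : ℝ) : ℝ := v / (1 - v)

/-- The matrix element `f(a,b,t)` of the determinant solution of the parallel TASEP. -/
def f (v : ℝ) (a b : ℤ) (t : ℕ) : ℝ :=
  if 1 ≤ a then
    (1 - v) ^ t * (-1 : ℝ) ^ a *
      ∑' k : ℕ, if 0 ≤ b + (k : ℤ) then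
        C ((t : ℤ) + a) (b + (k : ℤ)).toNat * C (a + (k : ℤ) - 1) k *
          lam v ^ (b + (k : ℤ)).toNat
      else 0
  else
    (1 - v) ^ t * (-1 : ℝ) ^ a *
      ∑' j : ℕ, if (j : ℤ) ≤ -a ∧ 0 ≤ b + (j : ℤ) then
        (-1 : ℝ) ^ j * C (-a) j * C ((t : ℤ) + a) (b + (j : ℤ)).toNat *
          lam v ^ (b + (j : ℤ)).toNat
      else 0

/-- Number of pairs of neighboring particles (occupied neighboring sites) in `x`. -/
def nPairs {P : ℕ} (x : Fin P → ℤ) : ℕ :=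
  (Finset.univ.filter fun p : Fin P × Fin P =>
    ((p.2 : ℕ) = (p.1 : ℕ) + 1) ∧ x p.2 = x p.1 + 1).card

/-- Number of clusters `N_c(x) = P - nPairs x`. -/
def Nc {P : ℕ} (x : Fin P → ℤ) : ℕ := P - nPairs x

/-- The matrix `F(X,Y,t)` with entries `f(i-j, x_i - y_j, t)`. -/
def Fmat (v : ℝ) {P : ℕ} (x y : Fin P → ℤ) (t : ℕ) : Matrix (Fin P) (Fin P) ℝ :=
  Matrix.of fun i j => f v ((i : ℤ) - (j : ℤ)) (x i - y j) t

/-- One-step transition probability of the parallel-update TASEP. -/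
def Tstep (v : ℝ) {P : ℕ} (x x' : Fin P → ℤ) : ℝ :=
  ∏ i : Fin P,
    if x i = x' i + 1 ∧ (∀ j : Fin P, (j : ℕ) = (i : ℕ) + 1 → x' i + 1 < x' j) then v
    else if x i = x' i ∧ (∀ j : Fin P, (j : ℕ) = (i : ℕ) + 1 → x' i + 1 < x' j) then 1 - v
    else if x i = x' i ∧ (∃ j : Fin P, (j : ℕ) = (i : ℕ) + 1 ∧ x' j = x' i + 1) then 1
    else 0

/-- Transformed transition probability `T₀(X,X') = (1-v)^(N_c(X)-N_c(X')) T(X,X')`. -/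
def T0 (v : ℝ) {P : ℕ} (x x' : Fin P → ℤ) : ℝ :=
  (1 - v) ^ ((Nc x : ℤ) - (Nc x' : ℤ)) * Tstep v x x'

/-- `shiftBy x k` subtracts `1` from the coordinates selected by `k`. -/
def shiftBy {P : ℕ} (x : Fin P → ℤ) (k : Fin P → Bool) : Fin P → ℤ :=
  fun i => x i - if k i then 1 else 0

/-- `t`-step probability of the parallel-update TASEP started from `x0`. -/
def Pt (v : ℝ) {P : ℕ} (x0 : Fin P → ℤ) : ℕ → (Fin P → ℤ) → ℝ
  | 0 => fun x => if x = x0 then 1 else 0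
  | t + 1 => fun x => ∑ k : Fin P → Bool,
      if StrictMono (shiftBy x k) then
        Tstep v x (shiftBy x k) * Pt v x0 t (shiftBy x k)
      else 0

/-- One-particle weight `F₀(x|t)`. -/
def F0 (v : ℝ) (x : ℤ) (t : ℕ) : ℝ :=
  if 0 ≤ x ∧ x ≤ (t : ℤ) then (t.choose x.toNat : ℝ) * v ^ x.toNat * (1 - v) ^ (t - x.toNat)
  else 0

/-- Schütz's functions `F_m(N|t)` for the backward sequential update. -/
def Fm (v : ℝ) (m : ℤ) (N : ℤ) (t : ℕ) : ℝ :=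
  if 0 < m then
    ∑' k : ℕ, ((k + m.toNat - 1).choose (m.toNat - 1) : ℝ) * F0 v (N + (k : ℤ)) t
  else if m = 0 then F0 v N t
  else
    ∑ k ∈ Finset.range (m.natAbs + 1),
      (-1 : ℝ) ^ k * (m.natAbs.choose k : ℝ) * F0 v (N + (k : ℤ)) t

/-- The functions `F̃_m(N|t)` for the parallel update. -/
def Ftil (v : ℝ) (m : ℤ) (N : ℤ) (t : ℕ) : ℝ :=
  if 0 < m then
    ∑ n ∈ Finset.range (m.toNat + 1),
      ∑' k : ℤ, if -(n : ℤ) ≤ k then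
        (m.toNat.choose n : ℝ) * ((m + (n : ℤ) + k - 1).toNat.choose ((n : ℤ) + k).toNat : ℝ) *
          lam v ^ n * F0 v (N + k) t
      else 0
  else if m = 0 then F0 v N t
  else
    ∑ n ∈ Finset.range (m.natAbs + 1),
      ∑' k : ℤ, if -(n : ℤ) ≤ k then
        (-1 : ℝ) ^ n * (m.natAbs.choose n : ℝ) *
          (((m.natAbs : ℤ) + (n : ℤ) + k - 1).toNat.choose ((n : ℤ) + k).toNat : ℝ) *
          (-(lam v)) ^ ((n : ℤ) + k).toNat * F0 v (N - k) t
      else 0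

/-- One-step transition probability of the TASEP with backward sequential update. -/
def TBw (v : ℝ) {P : ℕ} (x x' : Fin P → ℤ) : ℝ :=
  ∏ i : Fin P,
    if h : (i : ℕ) + 1 < P then
      if x' i + 1 < x' ⟨(i : ℕ) + 1, h⟩ ∨
          (x' ⟨(i : ℕ) + 1, h⟩ = x' i + 1 ∧ x ⟨(i : ℕ) + 1, h⟩ = x' ⟨(i : ℕ) + 1, h⟩ + 1) then
        (if x i = x' i + 1 then v else if x i = x' i then 1 - v else 0)
      else if x' ⟨(i : ℕ) + 1, h⟩ = x' i + 1 ∧ x ⟨(i : ℕ) + 1, h⟩ = x' ⟨(i : ℕ) + 1, h⟩ then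
        (if x i = x' i then 1 else 0)
      else 0
    else
      (if x i = x' i + 1 then v else if x i = x' i then 1 - v else 0)

/-- `t`-step probability of the backward-sequential-update TASEP started from `x0`. -/
def Pbw (v : ℝ) {P : ℕ} (x0 : Fin P → ℤ) : ℕ → (Fin P → ℤ) → ℝ
  | 0 => fun x => if x = x0 then 1 else 0
  | t + 1 => fun x => ∑ k : Fin P → Bool,
      if StrictMono (shiftBy x k) then
        TBw v x (shiftBy x k) * Pbw v x0 t (shiftBy x k)
      else 0

/-- Reversed-negated configuration `ι(X)_i = -x_{P+1-i}`. -/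
def iota {P : ℕ} (x : Fin P → ℤ) : Fin P → ℤ := fun i => - x i.rev

/-- `i` is a cluster head of `x` (first particle of a cluster). -/
def isHead {P : ℕ} (x : Fin P → ℤ) (i : Fin P) : Prop :=
  ∀ j : Fin P, (i : ℕ) = (j : ℕ) + 1 → x j + 1 < x i

/-- Position of the `i`-th walker at time `s`, given steps `ε`. -/
def walkerPos {P t : ℕ} (x0 : Fin P → ℤ) (ε : Fin P → Fin t → Bool) (i : Fin P) (s : ℕ) : ℤ :=
  x0 i + ((Finset.univ.filter fun u : Fin t => (u : ℕ) < s ∧ ε i u = true).card : ℤ)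

/-- General Bethe-ansatz sum with amplitudes `A`. -/
def betheSum {P : ℕ} (z : Fin P → ℂ) (A : Equiv.Perm (Fin P) → ℂ) (x : Fin P → ℤ) : ℂ :=
  ∑ σ : Equiv.Perm (Fin P), A σ * ∏ i : Fin P, z (σ i) ^ (-(x i))

/-- `ξ(z) = -(1+λz)/(1-1/z)`. -/
def xiC (v : ℝ) (z : ℂ) : ℂ := -(1 + (lam v : ℂ) * z) / (1 - 1 / z)

/-- Bethe amplitudes `A_σ = sgn(σ) ∏ ξ_{σ(i)}^{i-σ(i)}`. -/
def ampA (v : ℝ) {P : ℕ} (z : Fin P → ℂ) (σ : Equiv.Perm (Fin P)) : ℂ :=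
  ((Equiv.Perm.sign σ : ℤ) : ℂ) * ∏ i : Fin P, xiC v (z (σ i)) ^ ((i : ℤ) - (σ i : ℤ))

/-- The Bethe eigenfunction `B(x)`. -/
def betheB (v : ℝ) {P : ℕ} (z : Fin P → ℂ) (x : Fin P → ℤ) : ℂ :=
  betheSum z (ampA v z) x


section UpperSet

variable {α : Type*} [LinearOrder α] [Finite α] {A B : Set α} {σ : Equiv.Perm α}

/-- Nested case of `upperSet_eq_and_invariant`. -/
theorem upperSet_eq_and_invariant_of_subset (hA : IsUpperSet A)
    (hB : IsUpperSet B) (hAB : A ⊆ B) (hasc : ∀ i, i ≤ σ i → σ i ∈ B → i ∈ A) :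
    A = B ∧ ∀ i, σ i ∈ A ↔ i ∈ A := by
  have hpre : ∀ i, σ i ∈ B → i ∈ B := fun i hi =>
    (le_total i (σ i)).elim (fun h => hAB (hasc i h hi)) fun h => hB h hi
  have hmaps : Set.MapsTo σ B B :=
    Equiv.Perm.perm_symm_mapsTo_iff_mapsTo.1 fun i hi => hpre _ (by simpa using hi)
  have hBA : B ⊆ A := by
    intro i hi
    obtain ⟨q, hq, hmin⟩ := Set.exists_min_image B id B.toFinite ⟨i, hi⟩
    exact hA (hmin i hi) (hasc q (hmin _ (hmaps hq)) (hmaps hq))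
  obtain rfl := hAB.antisymm hBA
  exact ⟨rfl, fun i => ⟨hpre i, fun hi => hmaps hi⟩⟩

/-- Two upper sets of a finite linear order that a permutation relates by descents from `A` to `B`
and by ascents from `B` back to `A` coincide, and the permutation preserves them. -/
theorem upperSet_eq_and_invariant (hA : IsUpperSet A) (hB : IsUpperSet B)
    (hdesc : ∀ i, σ i ≤ i → i ∈ A → σ i ∈ B) (hasc : ∀ i, i ≤ σ i → σ i ∈ B → i ∈ A) :
    A = B ∧ ∀ i, σ i ∈ A ↔ i ∈ A := by
  rcases hA.total hB with h | h
  · exact upperSet_eq_and_invariant_of_subset hA hB h hasc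
  · obtain ⟨rfl, hinv⟩ := upperSet_eq_and_invariant_of_subset (σ := σ⁻¹) hB hA h fun i hi hmem => by
      simpa using hdesc (σ⁻¹ i) (by simpa using hi) hmem
    exact ⟨rfl, fun i => by simpa using (hinv (σ i)).symm⟩

end UpperSet

/-- A strictly increasing integer sequence minus its index is weakly increasing. -/
theorem monotone_sub_index {P : ℕ} {x : Fin P → ℤ} (hx : StrictMono x) :
    Monotone fun i : Fin P => x i - (i : ℤ) := by
  cases P with
  | zero => exact fun i => i.elim0
  | succ n =>
    refine Fin.monotone_iff_le_succ.2 fun i => ?_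
    have := hx i.castSucc_lt_succ
    simp only [Fin.val_castSucc, Fin.val_succ]
    push_cast
    omega

/-- Combinatorial core of Proposition 1: propagation of the inequalities along the
orbits of the permutation `σ`. -/
theorem orbit_inequalities
    (P : ℕ) (hP : 1 ≤ P) (x y : Fin P → ℤ) (hx : StrictMono x) (hy : StrictMono y)
    (σ : Equiv.Perm (Fin P))
    (h1 : ∀ i : Fin P, σ i = i → x i = y i)
    (h2 : ∀ i : Fin P, σ i < i → x i - y (σ i) ≤ (i : ℤ) - (σ i : ℤ))
    (h3 : ∀ i : Fin P, i < σ i → y (σ i) - x i ≤ (σ i : ℤ) - (i : ℤ)) :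
    (∀ i, x i = y i) ∧ ∀ i : Fin P, x i - x (σ i) = (i : ℤ) - (σ i : ℤ) := by
  have key (c : ℤ) := upperSet_eq_and_invariant (σ := σ)
    (A := {i | c ≤ x i - (i : ℤ)}) (B := {i | c ≤ y i - (i : ℤ)})
    (fun _ _ hij hi => le_trans hi (monotone_sub_index hx hij))
    (fun _ _ hij hi => le_trans hi (monotone_sub_index hy hij))
    (fun i hi hmem => by
      simp only [Set.mem_ofPred_eq] at hmem ⊢
      rcases hi.lt_or_eq with h | h
      · linarith [h2 i h]
      · rw [h]; linarith [h1 i h])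
    (fun i hi hmem => by
      simp only [Set.mem_ofPred_eq] at hmem ⊢
      rcases hi.lt_or_eq with h | h
      · linarith [h3 i h]
      · rw [← h] at hmem; linarith [h1 i h.symm])
  constructor
  · intro i
    have h : x i - (i : ℤ) = y i - (i : ℤ) :=
      eq_of_forall_le_iff fun c => Set.ext_iff.1 (key c).1 i
    linarith
  · intro i
    have h : x (σ i) - (σ i : ℤ) = x i - (i : ℤ) :=
      eq_of_forall_le_iff fun c => (key c).2 i
    linarith

end

end TASEP
end

section
/- For every configuration X of P particles, det F(X,X,0) = (1−v)^{N_c(X)−P} (equivalently, det F(X,X,0) = (1+λ)^{P−N_c(X)}). -/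
open Finset

namespace TASEP

attribute [local instance] Classical.propDecidable

noncomputable section

theorem C_natCast (m k : ℕ) : C (m : ℤ) k = (m.choose k : ℝ) := by
  have hk : (k.factorial : ℝ) ≠ 0 := by positivity
  rw [C, div_eq_iff hk, mul_comm, ← Nat.cast_mul, ← Nat.descFactorial_eq_factorial_mul_choose,
    ← descPochhammer_eval_eq_descFactorial, descPochhammer_eval_eq_prod_range]
  simp

theorem C_zero_right (n : ℤ) : C n 0 = 1 := by simp [C]

theorem f_zero_of_one_le (v : ℝ) {a b : ℤ} (ha : 1 ≤ a) (hab : a ≤ b) :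
    f v a b 0 = if b = a then (-lam v) ^ a.toNat else 0 := by
  lift a to ℕ using by lia
  lift b to ℕ using by lia
  rw [f, if_pos ha, tsum_eq_single 0]
  · have hb : (((b : ℤ) + ((0 : ℕ) : ℤ))).toNat = b := by simp
    rw [hb, if_pos (by positivity), Nat.cast_zero, zero_add, C_natCast, C_zero_right]
    split_ifs with h
    · obtain rfl : b = a := by exact_mod_cast h
      simp [neg_pow (lam v)]
    · rw [Nat.choose_eq_zero_of_lt (by lia)]
      simp
  · intro k hk
    rw [if_pos (by positivity), Nat.cast_zero, zero_add, C_natCast,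
      Nat.choose_eq_zero_of_lt (by lia)]
    simp

theorem f_zero_of_nonpos (v : ℝ) {a b : ℤ} (ha : a ≤ 0) (hba : b ≤ a) :
    f v a b 0 = if b = a then 1 else 0 := by
  obtain ⟨m, rfl⟩ : ∃ m : ℕ, a = -(m : ℤ) := ⟨a.natAbs, by lia⟩
  rw [f, if_neg (by lia), tsum_eq_single m]
  · split_ifs with h₁ h₂ h₂
    · subst h₂
      have hb : (-(m : ℤ) + (m : ℤ)).toNat = 0 := by simp
      rw [hb, neg_neg, C_natCast, C_zero_right]
      simp
    · lia
    · lia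
    · simp
  · intro k hk
    rw [if_neg (by lia)]

/-- The displacement of a particle configuration is at least the number of particles passed. -/
theorem sub_le_sub_of_strictMono {P : ℕ} {x : Fin P → ℤ} (hx : StrictMono x) {i j : Fin P}
    (hij : i ≤ j) : (j : ℤ) - (i : ℤ) ≤ x j - x i := by
  have hmono : Monotone fun k : Fin P => x k - (k : ℤ) := by
    cases P with
    | zero => exact i.elim0
    | succ n =>
      refine Fin.monotone_iff_le_succ.2 fun k => ?_
      have := hx k.castSucc_lt_succ
      simp only [Fin.val_succ, Fin.val_castSucc]
      push_cast
      lia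
  have := hmono hij
  simp only at this
  lia

theorem Fmat_self_zero_of_lt (v : ℝ) {P : ℕ} {x : Fin P → ℤ} (hx : StrictMono x) {i j : Fin P}
    (hij : j < i) : Fmat v x x 0 i j =
      if x i - x j = (i : ℤ) - (j : ℤ) then (-lam v) ^ ((i : ℤ) - (j : ℤ)).toNat else 0 := by
  have h : (j : ℕ) < (i : ℕ) := hij
  exact f_zero_of_one_le v (by lia) (sub_le_sub_of_strictMono hx hij.le)

theorem Fmat_self_zero_of_le (v : ℝ) {P : ℕ} {x : Fin P → ℤ} (hx : StrictMono x) {i j : Fin P}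
    (hij : i ≤ j) : Fmat v x x 0 i j =
      if x i - x j = (i : ℤ) - (j : ℤ) then 1 else 0 := by
  have h : (i : ℕ) ≤ (j : ℕ) := hij
  have := sub_le_sub_of_strictMono hx hij
  exact f_zero_of_nonpos v (by lia) (by lia)

theorem nPairs_succ {n : ℕ} (x : Fin (n + 1) → ℤ) :
    nPairs x = (Finset.univ.filter fun i : Fin n => x i.succ = x i.castSucc + 1).card := by
  symm
  refine Finset.card_bij (fun i _ => (i.castSucc, i.succ)) ?_ ?_ ?_
  · intro i hi
    simpa using hi
  · intro i _ j _ h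
    simpa using h
  · rintro ⟨p, q⟩ h
    simp only [Finset.mem_filter, Finset.mem_univ, true_and] at h
    have hp : (p : ℕ) < n := by lia
    have hq : q = Fin.succ ⟨p, hp⟩ := Fin.ext h.1
    subst hq
    exact ⟨⟨p, hp⟩, by simpa using h.2, rfl⟩

theorem nPairs_le {P : ℕ} (x : Fin P → ℤ) : nPairs x ≤ P := by
  cases P with
  | zero => simp [nPairs]
  | succ n =>
    rw [nPairs_succ]
    exact (Finset.card_filter_le _ _).trans (by simp)

/-- Adding to each row `lam v` times its predecessor, when the two particles are neighbors, makes
the matrix upper triangular. -/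
theorem det_Fmat_self_zero (v : ℝ) {n : ℕ} {x : Fin (n + 1) → ℤ} (hx : StrictMono x) :
    (Fmat v x x 0).det = (1 + lam v) ^ nPairs x := by
  set M := Fmat v x x 0 with hM
  let c : Fin n → ℝ := fun i => if x i.succ = x i.castSucc + 1 then lam v else 0
  let N : Matrix (Fin (n + 1)) (Fin (n + 1)) ℝ :=
    Matrix.of (Fin.cons (M 0) fun i j => M i.succ j + c i * M i.castSucc j)
  have hN_zero (j) : N 0 j = M 0 j := rfl
  have hN_succ (i : Fin n) (j) : N i.succ j = M i.succ j + c i * M i.castSucc j := rfl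
  have hdet : M.det = N.det :=
    Matrix.det_eq_of_forall_row_eq_smul_add_pred (fun i => -c i) (fun j => (hN_zero j).symm)
      fun i j => by rw [hN_succ]; ring
  have htri : N.BlockTriangular id := by
    intro i j hij
    simp only [id] at hij
    cases i using Fin.cases with
    | zero => exact absurd hij (Fin.not_lt_zero j)
    | succ i =>
      have hj : j ≤ i.castSucc := Fin.le_castSucc_iff.2 hij
      have hgap := sub_le_sub_of_strictMono hx hj
      have hstep := hx i.castSucc_lt_succ
      rw [hN_succ, hM, Fmat_self_zero_of_lt v hx hij]
      simp only [c, Fin.val_succ, Fin.val_castSucc] at hgap ⊢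
      push_cast
      by_cases hc : x i.succ = x i.castSucc + 1
      · rw [if_pos hc]
        obtain rfl | hlt := hj.eq_or_lt
        · rw [Fmat_self_zero_of_le v hx le_rfl]
          simp [hc]
        · have hlt' : (j : ℕ) < (i : ℕ) := hlt
          rw [Fmat_self_zero_of_lt v hx hlt]
          simp only [Fin.val_castSucc]
          have hexp : ((i : ℤ) + 1 - (j : ℤ)).toNat = ((i : ℤ) - (j : ℤ)).toNat + 1 := by omega
          rw [hexp, pow_succ]
          split_ifs <;> first | lia | ring
      · rw [if_neg hc, if_neg (by lia)]
        ring
  rw [hdet, Matrix.det_of_isUpperTriangular htri, Fin.prod_univ_succ, nPairs_succ, hN_zero, hM,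
    Fmat_self_zero_of_le v hx le_rfl, if_pos (by simp), one_mul, ← Finset.prod_const,
    Finset.prod_filter]
  refine Finset.prod_congr rfl fun i _ => ?_
  rw [hN_succ, hM, Fmat_self_zero_of_le v hx le_rfl,
    Fmat_self_zero_of_le v hx i.castSucc_lt_succ.le, if_pos (by simp)]
  simp only [c, Fin.val_succ, Fin.val_castSucc]
  push_cast
  split_ifs <;> first | lia | ring

/-- `det F(X,X,0) = (1-v)^(N_c(X)-P) = (1+λ)^(P-N_c(X))`. -/
theorem detF_diagonal
    (v : ℝ) (hv0 : 0 < v) (hv1 : v < 1) (P : ℕ) (hP : 1 ≤ P)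
    (x : Fin P → ℤ) (hx : StrictMono x) :
    (Fmat v x x 0).det = (1 - v) ^ ((Nc x : ℤ) - (P : ℤ)) ∧
    (Fmat v x x 0).det = (1 + lam v) ^ (P - Nc x) := by
  obtain ⟨n, rfl⟩ : ∃ n, P = n + 1 := ⟨P - 1, by lia⟩
  have hle := nPairs_le x
  have hsub : n + 1 - Nc x = nPairs x := by
    rw [Nc]
    lia
  have hexp : (Nc x : ℤ) - ((n + 1 : ℕ) : ℤ) = -(nPairs x : ℤ) := by
    rw [Nc]
    lia
  have hlam : 1 + lam v = (1 - v)⁻¹ := by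
    have : 1 - v ≠ 0 := by linarith
    rw [lam]
    field_simp
    ring
  rw [hsub, hexp, det_Fmat_self_zero v hx, hlam]
  simp

end

end TASEP
end

section
/- For all a, b ∈ ℤ and all t ∈ ℕ: f(a,b,t+1) = v·f(a,b−1,t) + (1−v)·f(a,b,t). -/
open Finset

namespace TASEP

attribute [local instance] Classical.propDecidable

noncomputable section

theorem C_succ_succ (n : ℤ) (k : ℕ) : C (n + 1) (k + 1) = C n k + C n (k + 1) := by
  have hk : ((k.factorial : ℕ) : ℝ) ≠ 0 := by positivity
  have hk' : (k : ℝ) + 1 ≠ 0 := by positivity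
  unfold C
  rw [Finset.prod_range_succ', Finset.prod_range_succ, Nat.factorial_succ]
  have h : ∏ i ∈ Finset.range k, (((n + 1 : ℤ) : ℝ) - ((i + 1 : ℕ) : ℝ)) =
      ∏ i ∈ Finset.range k, ((n : ℝ) - (i : ℝ)) :=
    Finset.prod_congr rfl fun i _ => by push_cast; ring
  rw [h]
  push_cast
  field_simp
  ring

theorem C_eq_zero {n : ℤ} {k : ℕ} (h0 : 0 ≤ n) (hk : n < k) : C n k = 0 := by
  lift n to ℕ using h0
  unfold C
  rw [Finset.prod_eq_zero (i := n) (Finset.mem_range.2 (by exact_mod_cast hk)) (by simp)]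
  simp

/-- The coefficient of `z ^ m` in `(1 + l * z) ^ n`, for an integer exponent `m`. -/
def binomCoeff (l : ℝ) (n m : ℤ) : ℝ :=
  if 0 ≤ m then C n m.toNat * l ^ m.toNat else 0

theorem binomCoeff_succ (l : ℝ) (n m : ℤ) :
    binomCoeff l (n + 1) m = l * binomCoeff l n (m - 1) + binomCoeff l n m := by
  unfold binomCoeff
  rcases lt_trichotomy m 0 with h | rfl | h
  · rw [if_neg (by omega), if_neg (by omega), if_neg (by omega), mul_zero, add_zero]
  · simp [C]
  · obtain ⟨k, rfl⟩ : ∃ k : ℕ, m = (k : ℤ) + 1 := ⟨(m - 1).toNat, by omega⟩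
    have h1 : ((k : ℤ) + 1).toNat = k + 1 := by omega
    rw [if_pos h.le, if_pos (by omega), if_pos h.le, h1, add_sub_cancel_right, Int.toNat_natCast,
      C_succ_succ]
    ring

theorem binomCoeff_eq_zero {l : ℝ} {n m : ℤ} (hn : 0 ≤ n) (hm : n < m) :
    binomCoeff l n m = 0 := by
  rw [binomCoeff, C_eq_zero hn (by omega)]
  simp

/-- The coefficient of `z ^ k` in `(1 - z) ^ (-a)`. -/
def weight (a : ℤ) (k : ℕ) : ℝ :=
  if 1 ≤ a then C (a + (k : ℤ) - 1) k else if (k : ℤ) ≤ -a then (-1 : ℝ) ^ k * C (-a) k else 0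

theorem f_eq_tsum (v : ℝ) (a b : ℤ) (t : ℕ) :
    f v a b t = (1 - v) ^ t * (-1 : ℝ) ^ a *
      ∑' k : ℕ, weight a k * binomCoeff (lam v) (t + a) (b + k) := by
  unfold f weight binomCoeff
  split_ifs with ha
  · congr 1
    refine tsum_congr fun k => ?_
    split_ifs <;> ring
  · congr 1
    refine tsum_congr fun k => ?_
    by_cases h1 : (k : ℤ) ≤ -a <;> by_cases h2 : 0 ≤ b + (k : ℤ) <;> simp [h1, h2]
    ring

theorem summable_weight_mul_binomCoeff (l : ℝ) (a b : ℤ) (t : ℕ) :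
    Summable fun k : ℕ => weight a k * binomCoeff l (t + a) (b + k) := by
  refine summable_of_ne_finset_zero (s := Finset.range (a.natAbs + b.natAbs + t + 1)) fun k hk => ?_
  rw [Finset.mem_range] at hk
  by_cases ha : 1 ≤ a
  · rw [binomCoeff_eq_zero (by omega) (by omega), mul_zero]
  · rw [weight, if_neg ha, if_neg (by omega), zero_mul]

/-- The free one-particle evolution equation: `f(a,b,t+1) = v f(a,b-1,t) + (1-v) f(a,b,t)`. -/
theorem f_free_evolution (v : ℝ) (hv0 : 0 < v) (hv1 : v < 1) (a b : ℤ) (t : ℕ) :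
    f v a b (t + 1) = v * f v a (b - 1) t + (1 - v) * f v a b t := by
  have hsum : ∑' k : ℕ, weight a k * binomCoeff (lam v) ((t + 1 : ℕ) + a) (b + k) =
      lam v * ∑' k : ℕ, weight a k * binomCoeff (lam v) (t + a) (b - 1 + k) +
        ∑' k : ℕ, weight a k * binomCoeff (lam v) (t + a) (b + k) := by
    rw [← tsum_mul_left, ← ((summable_weight_mul_binomCoeff (lam v) a (b - 1) t).mul_left
      (lam v)).tsum_add (summable_weight_mul_binomCoeff (lam v) a b t)]
    refine tsum_congr fun k => ?_
    rw [show ((t + 1 : ℕ) : ℤ) + a = t + a + 1 by push_cast; ring, binomCoeff_succ,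
      show b + (k : ℤ) - 1 = b - 1 + k by ring]
    ring
  have hlam : (1 - v) * lam v = v := mul_div_cancel₀ v (sub_pos.2 hv1).ne'
  rw [f_eq_tsum, f_eq_tsum, f_eq_tsum, hsum, pow_succ]
  set S := ∑' k : ℕ, weight a k * binomCoeff (lam v) (t + a) (b - 1 + k)
  linear_combination (1 - v) ^ t * (-1 : ℝ) ^ a * S * hlam

end

end TASEP
end

section
/- For all configurations X, X⁰ of P particles and all t ∈ ℕ: det F(X,X⁰,t+1) = Σ_{X′} T₀(X,X′)·det F(X′,X⁰,t), where the (finite) sum runs over all configurations X′ with x_i − 1 ≤ x′_i ≤ x_i for every i. -/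
open Finset

namespace TASEP

attribute [local instance] Classical.propDecidable

noncomputable section

theorem C_eq_zero_of_lt {n : ℤ} {k : ℕ} (hn : 0 ≤ n) (hk : n < k) : C n k = 0 := by
  lift n to ℕ using hn
  rw [C, Finset.prod_eq_zero (i := n) (by simp; omega) (by simp), zero_div]

theorem C_add_sub_one (a : ℤ) (k : ℕ) : C (a + k - 1) k = (-1) ^ k * C (-a) k := by
  have h : ∏ i ∈ Finset.range k, (((a + k - 1 : ℤ) : ℝ) - (i : ℝ))
      = ∏ i ∈ Finset.range k, (-1 * (((-a : ℤ) : ℝ) - (i : ℝ))) := by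
    rw [← Finset.prod_range_reflect]
    refine Finset.prod_congr rfl fun i hi => ?_
    have hi' : i + 1 ≤ k := Finset.mem_range.1 hi
    rw [Nat.sub_sub, Nat.cast_sub (by omega)]
    push_cast
    ring
  rw [C, h, Finset.prod_mul_distrib, C]
  simp [mul_div_assoc]

theorem binomCoeff_add_one (l : ℝ) (n m : ℤ) :
    binomCoeff l (n + 1) m = binomCoeff l n m + l * binomCoeff l n (m - 1) := by
  rcases lt_trichotomy m 0 with hm | rfl | hm
  · simp [binomCoeff, hm.not_ge, show ¬ (1 ≤ m) by omega]
  · simp [binomCoeff, C_zero_right]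
  · obtain ⟨k, rfl⟩ : ∃ k : ℕ, m = k + 1 := ⟨(m - 1).toNat, by omega⟩
    have h1 : ((k : ℤ) + 1).toNat = k + 1 := by omega
    have h2 : (0 : ℤ) ≤ k + 1 := by omega
    simp only [binomCoeff, h1, h2, if_true, add_sub_cancel_right, Int.toNat_natCast,
      Int.natCast_nonneg, C_succ_succ]
    ring

/-- Coefficient of `z ^ b` in `(1 + l z) ^ n (1 - 1 / z) ^ m`, the first factor being expanded
in powers of `z` and the second one in powers of `1 / z`. -/
def laurentCoeff (l : ℝ) (n m b : ℤ) : ℝ :=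
  ∑' k : ℕ, binomCoeff l n (b + k) * ((-1) ^ k * C m k)

theorem summable_laurentCoeff (l : ℝ) {n m : ℤ} (h : 0 ≤ n + m) (b : ℤ) :
    Summable fun k : ℕ => binomCoeff l n (b + k) * ((-1) ^ k * C m k) := by
  refine summable_of_ne_finset_zero (s := Finset.range (m.toNat + (n - b).toNat + 1))
    fun k hk => ?_
  simp only [Finset.mem_range, not_lt] at hk
  rcases le_or_gt 0 m with hm | hm
  · rw [C_eq_zero_of_lt hm (by omega), mul_zero, mul_zero]
  · rw [binomCoeff]
    split_ifs with hb
    · rw [C_eq_zero_of_lt (by omega) (by omega), zero_mul, zero_mul]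
    · rw [zero_mul]

theorem laurentCoeff_add_one_left (l : ℝ) {n m : ℤ} (h : 0 ≤ n + m) (b : ℤ) :
    laurentCoeff l (n + 1) m b = laurentCoeff l n m b + l * laurentCoeff l n m (b - 1) := by
  simp only [laurentCoeff]
  rw [← tsum_mul_left, ← (summable_laurentCoeff l h b).tsum_add
    ((summable_laurentCoeff l h (b - 1)).mul_left l)]
  refine tsum_congr fun k => ?_
  rw [binomCoeff_add_one, show b - 1 + (k : ℤ) = b + k - 1 by ring]
  ring

theorem laurentCoeff_add_one_right (l : ℝ) {n m : ℤ} (h : 0 ≤ n + m) (b : ℤ) :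
    laurentCoeff l n (m + 1) b = laurentCoeff l n m b - laurentCoeff l n m (b + 1) := by
  have h0 := summable_laurentCoeff l h b
  have h1 := summable_laurentCoeff l h (b + 1)
  have h2 : Summable fun k : ℕ => binomCoeff l n (b + k) * ((-1) ^ k * C (m + 1) k) :=
    summable_laurentCoeff l (by omega) b
  simp only [laurentCoeff]
  rw [h2.tsum_eq_zero_add, h0.tsum_eq_zero_add, add_sub_assoc,
    ← ((summable_nat_add_iff 1).2 h0).tsum_sub h1]
  congr 1
  refine tsum_congr fun k => ?_
  rw [C_succ_succ, show b + 1 + (k : ℤ) = b + ((k + 1 : ℕ) : ℤ) by push_cast; ring]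
  ring

theorem f_eq_laurentCoeff (v : ℝ) (a b : ℤ) (t : ℕ) :
    f v a b t = (1 - v) ^ t * (-1) ^ a * laurentCoeff (lam v) (t + a) (-a) b := by
  rw [f, laurentCoeff]
  split_ifs with ha
  · congr 1
    refine tsum_congr fun k => ?_
    rw [binomCoeff, C_add_sub_one]
    split_ifs <;> ring
  · congr 1
    refine tsum_congr fun k => ?_
    rw [binomCoeff]
    by_cases hk : (k : ℤ) ≤ -a
    · simp only [hk, true_and]
      split_ifs <;> ring
    · rw [if_neg fun h => hk h.1, C_eq_zero_of_lt (n := -a) (by omega) (by omega), mul_zero,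
        mul_zero]

theorem f_add_one (v : ℝ) (hv1 : v < 1) (a b : ℤ) (t : ℕ) :
    f v a b (t + 1) = (1 - v) * f v a b t + v * f v a (b - 1) t := by
  have hq : 1 - v ≠ 0 := by linarith
  simp only [f_eq_laurentCoeff]
  rw [show ((t + 1 : ℕ) : ℤ) + a = t + a + 1 by push_cast; ring,
    laurentCoeff_add_one_left _ (by omega)]
  have hl : (1 - v) * lam v = v := by rw [lam]; field_simp
  rw [pow_succ]
  linear_combination ((1 - v) ^ t * (-1) ^ a * laurentCoeff (lam v) (t + a) (-a) (b - 1)) * hl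

/-- Exchange relation between neighbouring rows of `Fmat`. -/
theorem f_add_one_sub (v : ℝ) (a b : ℤ) (t : ℕ) :
    (1 - v) * (f v (a + 1) (b + 1) t - f v (a + 1) b t) = f v a b (t + 1) := by
  simp only [f_eq_laurentCoeff]
  have h := laurentCoeff_add_one_right (lam v) (n := t + (a + 1)) (m := -(a + 1)) (by omega) b
  rw [show -(a + 1) + 1 = -a by ring] at h
  rw [show ((t + 1 : ℕ) : ℤ) + a = t + (a + 1) by push_cast; ring, h, pow_succ,
    zpow_add_one₀ (by norm_num)]
  ring

/-- Weight of the move `b` of particle `i`: cluster heads jump with probability `v`, all other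
particles stay. -/
def headWeight (v : ℝ) {P : ℕ} (x : Fin P → ℤ) (i : Fin P) (b : Bool) : ℝ :=
  if isHead x i then (if b then v else 1 - v) else (if b then 0 else 1)

theorem isHead_succ_iff {n : ℕ} (x : Fin (n + 1) → ℤ) (i : Fin n) :
    isHead x i.succ ↔ x i.castSucc + 1 < x i.succ := by
  constructor
  · intro h
    exact h i.castSucc (by simp)
  · intro h j hj
    have : j = i.castSucc := by ext; simp at hj ⊢; omega
    rwa [this]

theorem isHead_zero {n : ℕ} (x : Fin (n + 1) → ℤ) : isHead x 0 := by
  intro j hj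
  simp at hj

theorem sum_headWeight_mul_f (v : ℝ) (hv1 : v < 1) {P : ℕ} (x : Fin P → ℤ) (i : Fin P)
    (a y : ℤ) (t : ℕ) :
    ∑ b : Bool, headWeight v x i b * f v a (x i - (if b then 1 else 0) - y) t
      = if isHead x i then f v a (x i - y) (t + 1) else f v a (x i - y) t := by
  rw [Fintype.sum_bool, f_add_one v hv1]
  by_cases h : isHead x i
  · simp [headWeight, h, sub_right_comm (x i) 1 y, add_comm]
  · simp [headWeight, h]

theorem det_Fmat_succ_eq_det (v : ℝ) (hv1 : v < 1) {n : ℕ} (x y : Fin (n + 1) → ℤ)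
    (hx : StrictMono x) (t : ℕ) :
    (Fmat v x y (t + 1)).det = (Matrix.of fun i j : Fin (n + 1) =>
      if isHead x i then f v ((i : ℤ) - j) (x i - y j) (t + 1)
      else f v ((i : ℤ) - j) (x i - y j) t).det := by
  have hq : 1 - v ≠ 0 := by linarith
  refine Matrix.det_eq_of_forall_row_eq_smul_add_pred
    (fun i => if isHead x i.succ then 0 else -(v / (1 - v))) (fun j => ?_) fun i j => ?_
  · simp [Fmat, isHead_zero]
  · simp only [Fmat, Matrix.of_apply]
    split_ifs with h
    · simp
    · have hadj : x i.succ = x i.castSucc + 1 := by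
        have := hx (Fin.castSucc_lt_succ (i := i))
        rw [isHead_succ_iff] at h
        omega
      have hrel := f_add_one_sub v ((i : ℤ) - j) (x i.castSucc - y j) t
      rw [f_add_one v hv1, Fin.val_castSucc, ← hrel, hadj]
      rw [show ((i.succ : ℕ) : ℤ) - j = (i : ℤ) - j + 1 by rw [Fin.val_succ]; push_cast; ring,
        show x i.castSucc + 1 - y j - 1 = x i.castSucc - y j by ring,
        show x i.castSucc + 1 - y j = x i.castSucc - y j + 1 by ring]
      field_simp
      ring

/-- Multilinearity of the determinant in its rows. -/
theorem det_of_sum_mul {n : ℕ} {κ R : Type*} [Fintype κ] [CommRing R]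
    (w : Fin n → κ → R) (r : Fin n → κ → Fin n → R) :
    (Matrix.of fun i j => ∑ b, w i b * r i b j).det
      = ∑ k : Fin n → κ, (∏ i, w i (k i)) * (Matrix.of fun i => r i (k i)).det := by
  have h : (fun i j => ∑ b, w i b * r i b j) = fun i => ∑ b, w i b • r i b := by
    ext i j
    simp [Finset.sum_apply]
  calc _ = (Matrix.detRowAlternating (R := R) (n := Fin n)).toMultilinearMap
        (fun i => ∑ b, w i b • r i b) := by rw [← h]; rfl
    _ = _ := by
      rw [MultilinearMap.map_sum]
      refine Finset.sum_congr rfl fun k _ => ?_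
      rw [MultilinearMap.map_smul_univ, smul_eq_mul]
      rfl

theorem det_Fmat_succ_eq_sum (v : ℝ) (hv1 : v < 1) {n : ℕ} (x y : Fin (n + 1) → ℤ)
    (hx : StrictMono x) (t : ℕ) :
    (Fmat v x y (t + 1)).det
      = ∑ k : Fin (n + 1) → Bool,
          (∏ i, headWeight v x i (k i)) * (Fmat v (shiftBy x k) y t).det := by
  rw [det_Fmat_succ_eq_det v hv1 x y hx t]
  simp only [← sum_headWeight_mul_f v hv1]
  exact det_of_sum_mul (headWeight v x)
    fun i b j => f v ((i : ℤ) - j) (x i - (if b then 1 else 0) - y j) t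

theorem card_univ_sub_nPairs {P : ℕ} (x : Fin P → ℤ) (p : Fin P → Prop)
    (hp : (Finset.univ.filter fun i => ¬ p i).card = nPairs x) :
    (Finset.univ.filter p).card = Nc x := by
  have := Finset.card_filter_add_card_filter_not (s := (Finset.univ : Finset (Fin P))) p
  rw [hp, Finset.card_univ, Fintype.card_fin] at this
  rw [Nc]
  omega

/-- `i` is a cluster tail of `x` (last particle of a cluster). -/
def isTail {P : ℕ} (x : Fin P → ℤ) (i : Fin P) : Prop :=
  ∀ j : Fin P, (j : ℕ) = (i : ℕ) + 1 → x i + 1 < x j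

theorem not_isHead_iff {P : ℕ} {x : Fin P → ℤ} (hx : StrictMono x) (i : Fin P) :
    ¬ isHead x i ↔ ∃ j : Fin P, (i : ℕ) = j + 1 ∧ x i = x j + 1 := by
  simp only [isHead, not_forall]
  constructor
  · rintro ⟨j, hj, h⟩
    have := hx (show j < i by rw [Fin.lt_def]; omega)
    exact ⟨j, hj, by omega⟩
  · rintro ⟨j, hj, h⟩
    exact ⟨j, hj, by omega⟩

theorem not_isTail_iff {P : ℕ} {x : Fin P → ℤ} (hx : StrictMono x) (i : Fin P) :
    ¬ isTail x i ↔ ∃ j : Fin P, (j : ℕ) = i + 1 ∧ x j = x i + 1 := by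
  simp only [isTail, not_forall]
  constructor
  · rintro ⟨j, hj, h⟩
    have := hx (show i < j by rw [Fin.lt_def]; omega)
    exact ⟨j, hj, by omega⟩
  · rintro ⟨j, hj, h⟩
    exact ⟨j, hj, by omega⟩

theorem card_isHead {P : ℕ} {x : Fin P → ℤ} (hx : StrictMono x) :
    (Finset.univ.filter fun i => isHead x i).card = Nc x := by
  refine card_univ_sub_nPairs x _ (Eq.symm ?_)
  refine Finset.card_bij (fun p _ => p.2) ?_ ?_ ?_
  · intro p hp
    simp only [Finset.mem_filter, Finset.mem_univ, true_and, not_isHead_iff hx] at hp ⊢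
    exact ⟨p.1, hp⟩
  · intro p hp q hq h
    simp only [Finset.mem_filter, Finset.mem_univ, true_and] at hp hq
    refine Prod.ext (Fin.ext ?_) h
    have := congrArg Fin.val h
    omega
  · intro i hi
    simp only [Finset.mem_filter, Finset.mem_univ, true_and, not_isHead_iff hx] at hi
    obtain ⟨j, hj⟩ := hi
    exact ⟨(j, i), by simpa using hj, rfl⟩

theorem card_isTail {P : ℕ} {x : Fin P → ℤ} (hx : StrictMono x) :
    (Finset.univ.filter fun i => isTail x i).card = Nc x := by
  refine card_univ_sub_nPairs x _ (Eq.symm ?_)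
  refine Finset.card_bij (fun p _ => p.1) ?_ ?_ ?_
  · intro p hp
    simp only [Finset.mem_filter, Finset.mem_univ, true_and, not_isTail_iff hx] at hp ⊢
    exact ⟨p.2, hp⟩
  · intro p hp q hq h
    simp only [Finset.mem_filter, Finset.mem_univ, true_and] at hp hq
    refine Prod.ext h (Fin.ext ?_)
    have := congrArg Fin.val h
    omega
  · intro i hi
    simp only [Finset.mem_filter, Finset.mem_univ, true_and, not_isTail_iff hx] at hi
    obtain ⟨j, hj⟩ := hi
    exact ⟨(i, j), by simpa using hj, rfl⟩

theorem shiftBy_of_true {P : ℕ} (x : Fin P → ℤ) {k : Fin P → Bool} {i : Fin P}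
    (h : k i = true) : shiftBy x k i = x i - 1 := by simp [shiftBy, h]

theorem shiftBy_of_ne_true {P : ℕ} (x : Fin P → ℤ) {k : Fin P → Bool} {i : Fin P}
    (h : ¬ k i = true) : shiftBy x k i = x i := by simp [shiftBy, h]

theorem strictMono_shiftBy {P : ℕ} {x : Fin P → ℤ} (hx : StrictMono x) {k : Fin P → Bool}
    (hk : ∀ i, k i = true → isHead x i) : StrictMono (shiftBy x k) := by
  intro i j hij
  have hxij := hx hij
  have hi : shiftBy x k i ≤ x i := by rw [shiftBy]; split_ifs <;> omega
  by_cases h : k j = true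
  · rw [shiftBy_of_true x h]
    obtain ⟨m, hm⟩ : ∃ m : Fin P, (j : ℕ) = m + 1 :=
      ⟨⟨j - 1, by omega⟩, by rw [Fin.lt_def] at hij; simp; omega⟩
    have h1 := hk j h m hm
    have h2 : x i ≤ x m := hx.monotone (by rw [Fin.le_def]; rw [Fin.lt_def] at hij; omega)
    omega
  · rw [shiftBy_of_ne_true x h]
    omega

theorem Tstep_shiftBy_eq_zero (v : ℝ) {P : ℕ} {x : Fin P → ℤ} (hx : StrictMono x)
    {k : Fin P → Bool} (hs : StrictMono (shiftBy x k)) {i : Fin P} (hki : k i = true)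
    (hi : ¬ isHead x i) : Tstep v x (shiftBy x k) = 0 := by
  obtain ⟨j, hj, hxj⟩ := (not_isHead_iff hx i).1 hi
  have hlt := hs (show j < i by rw [Fin.lt_def]; omega)
  have hki' := shiftBy_of_true x hki
  have hkj : shiftBy x k j = x j - 1 := by
    by_cases h : k j = true
    · exact shiftBy_of_true x h
    · rw [shiftBy_of_ne_true x h] at hlt
      omega
  refine Finset.prod_eq_zero (Finset.mem_univ j) ?_
  rw [if_neg, if_neg, if_neg]
  · rintro ⟨h, -⟩
    omega
  · rintro ⟨h, -⟩
    omega
  · rintro ⟨-, h⟩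
    have := h i hj
    omega

theorem isTail_shiftBy {P : ℕ} {x : Fin P → ℤ} (hx : StrictMono x) {k : Fin P → Bool}
    (hk : ∀ i, k i = true → isHead x i) {i : Fin P} (hi : k i = true) :
    isTail (shiftBy x k) i := by
  intro j hj
  have hij := hx (show i < j by rw [Fin.lt_def]; omega)
  rw [shiftBy_of_true x hi]
  by_cases h : k j = true
  · have := hk j h i hj
    rw [shiftBy_of_true x h]
    omega
  · rw [shiftBy_of_ne_true x h]
    omega

theorem Tstep_shiftBy (v : ℝ) (hv1 : v < 1) {P : ℕ} {x : Fin P → ℤ} (hx : StrictMono x)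
    {k : Fin P → Bool} (hk : ∀ i, k i = true → isHead x i) :
    Tstep v x (shiftBy x k)
      = (1 - v) ^ Nc (shiftBy x k) * ∏ i, if k i = true then v / (1 - v) else 1 := by
  have hq : 1 - v ≠ 0 := by linarith
  have hs := strictMono_shiftBy hx hk
  rw [← card_isTail hs, ← Finset.prod_const, Finset.prod_filter, ← Finset.prod_mul_distrib]
  refine Finset.prod_congr rfl fun i _ => ?_
  by_cases h : k i = true
  · have ht := isTail_shiftBy hx hk h
    rw [if_pos ⟨by rw [shiftBy_of_true x h]; ring, ht⟩, if_pos ht, if_pos h]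
    field_simp
  · have he := shiftBy_of_ne_true x h
    rw [if_neg (by omega), if_neg h, mul_one]
    by_cases ht : isTail (shiftBy x k) i
    · rw [if_pos ⟨he.symm, ht⟩, if_pos ht]
    · rw [if_neg fun h => ht h.2, if_pos ⟨he.symm, (not_isTail_iff hs i).1 ht⟩, if_neg ht]

theorem prod_headWeight (v : ℝ) (hv1 : v < 1) {P : ℕ} {x : Fin P → ℤ} (hx : StrictMono x)
    {k : Fin P → Bool} (hk : ∀ i, k i = true → isHead x i) :
    ∏ i, headWeight v x i (k i)
      = (1 - v) ^ Nc x * ∏ i, if k i = true then v / (1 - v) else 1 := by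
  have hq : 1 - v ≠ 0 := by linarith
  rw [← card_isHead hx, ← Finset.prod_const, Finset.prod_filter, ← Finset.prod_mul_distrib]
  refine Finset.prod_congr rfl fun i _ => ?_
  by_cases h : k i = true
  · rw [headWeight, if_pos (hk i h), if_pos (hk i h), if_pos h, if_pos h]
    field_simp
  · rw [headWeight, if_neg h, if_neg h, if_neg h, mul_one]

theorem T0_shiftBy (v : ℝ) (hv1 : v < 1) {P : ℕ} {x : Fin P → ℤ} (hx : StrictMono x)
    {k : Fin P → Bool} (hk : ∀ i, k i = true → isHead x i) :
    T0 v x (shiftBy x k) = ∏ i, headWeight v x i (k i) := by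
  have hq : 1 - v ≠ 0 := by linarith
  rw [T0, Tstep_shiftBy v hv1 hx hk, prod_headWeight v hv1 hx hk, zpow_sub₀ hq, zpow_natCast,
    zpow_natCast]
  field_simp

/-- Evolution of the determinant: `det F(X,X⁰,t+1) = Σ_{X'} T₀(X,X') det F(X',X⁰,t)`. -/
theorem detF_master_equation
    (v : ℝ) (hv0 : 0 < v) (hv1 : v < 1) (P : ℕ) (hP : 1 ≤ P)
    (x x0 : Fin P → ℤ) (hx : StrictMono x) (hx0 : StrictMono x0) (t : ℕ) :
    (Fmat v x x0 (t + 1)).det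
      = ∑ k : Fin P → Bool,
          if StrictMono (shiftBy x k) then
            T0 v x (shiftBy x k) * (Fmat v (shiftBy x k) x0 t).det
          else 0 := by
  obtain ⟨n, rfl⟩ : ∃ n, P = n + 1 := ⟨P - 1, by omega⟩
  rw [det_Fmat_succ_eq_sum v hv1 x x0 hx t]
  refine Finset.sum_congr rfl fun k _ => ?_
  by_cases hk : ∀ i, k i = true → isHead x i
  · rw [if_pos (strictMono_shiftBy hx hk), T0_shiftBy v hv1 hx hk]
  · push Not at hk
    obtain ⟨i, hki, hi⟩ := hk
    rw [Finset.prod_eq_zero (Finset.mem_univ i) (by simp [headWeight, hki, hi]), zero_mul]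
    split_ifs with hs
    · rw [T0, Tstep_shiftBy_eq_zero v hx hs hki hi, mul_zero, zero_mul]
    · rfl

end

end TASEP
end
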